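/- Every automorphism of the Lie group SU(n) (n ≥ 2) has either the form g ↦ h₀ g h₀⁻¹ or the form g ↦ h₀ ḡ h₀⁻¹ for some h₀ ∈ SU(n), where ḡ denotes entrywise complex conjugation. -/

import Mathlib

section

open Matrix

/-- A continuous homomorphism from `(ℝ, +)` to `(ℂ, *)` is an exponential. -/
theorem exists_eq_cexp_of_continuous_of_map_add {f : ℝ → ℂ} (hf : Continuous f) (h0 : f 0 = 1)
    (hadd : ∀ x y, f (x + y) = f x * f y) : ∃ c : ℂ, ∀ x : ℝ, f x = Complex.exp (c * x) := by
  set F : ℝ → ℂ := fun x => ∫ t in (0 : ℝ)..x, f t with hF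
  have hFd (x : ℝ) : HasDerivAt F (f x) x :=
    intervalIntegral.integral_hasDerivAt_right (hf.intervalIntegrable _ _)
      (hf.stronglyMeasurableAtFilter _ _) hf.continuousAt
  obtain ⟨a, ha⟩ : ∃ a, F a ≠ 0 := by
    by_contra! h
    have h1 := (hFd 0).unique ((funext h : F = fun _ => 0) ▸ hasDerivAt_const (0 : ℝ) (0 : ℂ))
    simp [h0] at h1
  have hmul (x : ℝ) : f x = (F (a + x) - F x) / F a := by
    rw [eq_div_iff ha]
    simp only [hF]
    rw [intervalIntegral.integral_interval_sub_left (hf.intervalIntegrable _ _)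
      (hf.intervalIntegrable _ _), ← intervalIntegral.integral_const_mul]
    have h := intervalIntegral.integral_comp_add_right (a := 0) (b := a) f x
    rw [zero_add] at h
    rw [← h]
    exact intervalIntegral.integral_congr fun t _ => by simp [hadd, mul_comm]
  have hd0 : ∃ c, HasDerivAt f c 0 := by
    have h := (((hFd (a + 0)).comp_const_add a 0).sub (hFd 0)).div_const (F a)
    exact ⟨_, h.congr_of_eventuallyEq (.of_forall hmul)⟩
  obtain ⟨c, hc⟩ := hd0
  have hd (x : ℝ) : HasDerivAt f (f x * c) x := by
    have h1 : HasDerivAt (fun y => f x * f (y - x)) (f x * c) x := by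
      have hc' : HasDerivAt f c (x - x) := by simpa using hc
      exact (hc'.comp_sub_const x x).const_mul (f x)
    refine h1.congr_of_eventuallyEq (.of_forall fun y => ?_)
    simp [← hadd]
  refine ⟨c, fun x => ?_⟩
  have he (y : ℝ) : HasDerivAt (fun y : ℝ => Complex.exp (-(c * y)))
      (Complex.exp (-(c * y)) * -c) y := by
    have h1 : HasDerivAt (fun y : ℝ => -(c * (y : ℂ))) (-c) y := by
      simpa using! ((Complex.ofRealCLM.hasDerivAt (x := y)).const_mul c).neg
    exact h1.cexp
  have hconst := is_const_of_deriv_eq_zero (f := fun y : ℝ => f y * Complex.exp (-(c * y)))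
    (fun y => ((hd y).mul (he y)).differentiableAt)
    (fun y => ((hd y).mul (he y)).deriv.trans (by ring)) x 0
  simp only [h0, Complex.ofReal_zero, mul_zero, neg_zero, Complex.exp_zero, mul_one] at hconst
  rw [← mul_one (f x), ← Complex.exp_zero, ← neg_add_cancel (c * (x : ℂ)), Complex.exp_add,
    ← mul_assoc, hconst, one_mul]

theorem exists_eq_cexp_mul_I {f : ℝ → ℂ} (hf : Continuous f)
    (hadd : ∀ x y, f (x + y) = f x * f y) (hnorm : ∀ x, ‖f x‖ = 1) :
    ∃ m : ℝ, ∀ x : ℝ, f x = Complex.exp ((m * x : ℝ) * Complex.I) := by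
  have h0 : f 0 = 1 := by
    have h := hadd 0 0
    rw [add_zero] at h
    have hne : f 0 ≠ 0 := by
      intro h'; have := hnorm 0; simp [h'] at this
    exact (mul_eq_left₀ hne).mp h.symm
  obtain ⟨c, hc⟩ := exists_eq_cexp_of_continuous_of_map_add hf h0 hadd
  have hre : c.re = 0 := by
    have h := hnorm 1
    rw [hc, Complex.norm_exp] at h
    simpa using h
  refine ⟨c.im, fun x => ?_⟩
  rw [hc]
  congr 1
  apply Complex.ext <;> simp [hre]

theorem cexp_sum_sub_mean_mul_I {ι : Type*} [Fintype ι] [Nonempty ι] (x : ι → ℝ) :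
    ∏ j, Complex.exp ((x j - (∑ k, x k) / Fintype.card ι : ℝ) * Complex.I) = 1 := by
  rw [← Complex.exp_sum, ← Finset.sum_mul, ← Complex.ofReal_sum, Finset.sum_sub_distrib,
    Finset.sum_const, Finset.card_univ, nsmul_eq_mul, mul_div_cancel₀, sub_self]
  · simp
  · simp

variable {ι : Type*} [Fintype ι] [DecidableEq ι]

theorem Matrix.smul_mem_unitaryGroup {U : Matrix ι ι ℂ} (hU : U ∈ unitaryGroup ι ℂ) {c : ℂ}
    (hc : ‖c‖ = 1) : c • U ∈ unitaryGroup ι ℂ := by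
  rw [mem_unitaryGroup_iff'] at hU ⊢
  rw [star_smul, smul_mul_smul_comm, hU]
  have : star c * c = 1 := by simpa [hc] using Complex.conj_mul' c
  rw [this, one_smul]

/-- A unitary matrix can be rescaled to have determinant one. -/
theorem Matrix.exists_smul_mem_specialUnitaryGroup [Nonempty ι] {U : Matrix ι ι ℂ}
    (hU : U ∈ unitaryGroup ι ℂ) :
    ∃ c : ℂ, ‖c‖ = 1 ∧ c • U ∈ specialUnitaryGroup ι ℂ := by
  have hdet : ‖U.det‖ = 1 := CStarRing.norm_of_mem_unitary (det_of_mem_unitary hU)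
  obtain ⟨c, hc⟩ := IsAlgClosed.exists_pow_nat_eq (U.det)⁻¹ (Fintype.card_pos (α := ι))
  have hc1 : ‖c‖ = 1 := by
    have : ‖c‖ ^ Fintype.card ι = 1 := by rw [← norm_pow, hc, norm_inv, hdet, inv_one]
    exact (pow_eq_one_iff_of_nonneg (norm_nonneg c) Fintype.card_ne_zero).mp this
  refine ⟨c, hc1, smul_mem_unitaryGroup hU hc1, ?_⟩
  have : U.det ≠ 0 := by intro h; simp [h] at hdet
  simp [hc, this]

open scoped Matrix.Norms.L2Operator in
theorem Matrix.span_specialUnitaryGroup [Nonempty ι] :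
    Submodule.span ℂ (specialUnitaryGroup ι ℂ : Set (Matrix ι ι ℂ)) = ⊤ := by
  rw [eq_top_iff, ← CStarAlgebra.span_unitary (Matrix ι ι ℂ), Submodule.span_le]
  intro U hU
  obtain ⟨c, hc, hcU⟩ := exists_smul_mem_specialUnitaryGroup (U := U) hU
  have hc0 : c ≠ 0 := by intro h; simp [h] at hc
  have := Submodule.smul_mem _ c⁻¹ (Submodule.subset_span (R := ℂ) hcU)
  rwa [smul_smul, inv_mul_cancel₀ hc0, one_smul] at this

theorem exists_norm_eq_one_isUnit_one_add_smul (U : Matrix ι ι ℂ) :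
    ∃ c : ℂ, ‖c‖ = 1 ∧ IsUnit (1 + c • U) := by
  have hinf : (Metric.sphere (0 : ℂ) 1).Infinite := by
    refine (isPreconnected_sphere (by simp) 0 1).infinite_of_nontrivial ?_
    exact ⟨1, by simp, -1, by simp, by norm_num⟩
  obtain ⟨c, hc, hcU⟩ := (hinf.sdiff (t := (fun z => -z⁻¹) '' spectrum ℂ U)
    ((Matrix.finite_spectrum U).image _)).nonempty
  have hc1 : ‖c‖ = 1 := by simpa using hc
  have hc0 : c ≠ 0 := by intro h; simp [h] at hc1
  refine ⟨c, hc1, ?_⟩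
  have hns : -c⁻¹ ∉ spectrum ℂ U := fun h => hcU ⟨_, h, by simp⟩
  rw [spectrum.notMem_iff] at hns
  have h2 := (hns.smul (Units.mk0 (-c) (neg_ne_zero.mpr hc0)))
  convert h2 using 1
  rw [Units.smul_def, Units.val_mk0, smul_sub, Algebra.algebraMap_eq_smul_one, smul_smul]
  simp [hc0]

/-- A unitary matrix is unitarily diagonalizable: apply the spectral theorem to a Cayley
transform. -/
theorem Matrix.exists_diagonal_of_mem_unitaryGroup {U : Matrix ι ι ℂ}
    (hU : U ∈ unitaryGroup ι ℂ) :
    ∃ V ∈ unitaryGroup ι ℂ, ∃ d : ι → ℂ, U = V * diagonal d * star V := by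
  obtain ⟨c, hc, hunit⟩ := exists_norm_eq_one_isUnit_one_add_smul U
  have hW := smul_mem_unitaryGroup hU hc
  set W := c • U with hWdef
  have hc0 : c ≠ 0 := by intro h; simp [h] at hc
  obtain ⟨A, hA⟩ := hunit
  set B : Matrix ι ι ℂ := ↑A⁻¹ with hB
  have hAB : (1 + W) * B = 1 := by rw [← hA]; exact A.mul_inv
  have hBA : B * (1 + W) = 1 := by rw [← hA]; exact A.inv_mul
  have hW1 : star W * W = 1 := hW.1
  have hW2 : W * star W = 1 := hW.2
  set H := Complex.I • ((1 - W) * B) with hHdef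
  have hsB : star B = W * B := by
    have h1 : star B * (1 + star W) = 1 := by
      rw [← star_one, ← star_add, ← star_mul, hAB]
    calc star B = star B * (1 + star W) * W * B := by
          rw [mul_assoc (star B), add_mul, hW1, one_mul, add_comm, mul_assoc, hAB, mul_one]
      _ = W * B := by rw [h1, one_mul]
  have hcomm : B * W = W * B := by
    calc B * W = B * (W * (1 + W)) * B := by
          simp only [mul_assoc]; rw [hAB, mul_one]
      _ = B * (1 + W) * W * B := by congr 1; simp only [mul_assoc]; congr 1; noncomm_ring
      _ = W * B := by rw [hBA, one_mul]
  have hH : H.IsHermitian := by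
    change star H = H
    rw [hHdef, star_smul, star_mul, star_sub, star_one, hsB, ← hcomm, mul_assoc, mul_sub, mul_one,
      hW2, sub_mul, one_mul, mul_sub, mul_one, hcomm]
    simp only [Complex.star_def, Complex.conj_I, neg_smul]
    rw [← smul_neg, neg_sub]
  have hHW : H * (1 + W) = Complex.I • (1 - W) := by
    rw [hHdef, smul_mul_assoc, mul_assoc, hBA, mul_one]
  set V : Matrix ι ι ℂ := ↑hH.eigenvectorUnitary with hV
  have hVm : V ∈ unitaryGroup ι ℂ := hH.eigenvectorUnitary.2
  have hV1 : star V * V = 1 := hVm.1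
  have hV2 : V * star V = 1 := hVm.2
  set L : ι → ℂ := RCLike.ofReal ∘ hH.eigenvalues with hL
  have hspec : H = V * diagonal L * star V := hH.spectral_theorem
  set G := star V * W * V with hG
  have hWG : W = V * G * star V := by
    rw [hG]; simp only [← mul_assoc]; rw [hV2, one_mul, mul_assoc, hV2, mul_one]
  have hLG : diagonal L * (1 + G) = Complex.I • (1 - G) := by
    have h1 : star V * (H * (1 + W)) * V = star V * (Complex.I • (1 - W)) * V := by rw [hHW]
    have e1 : star V * (Complex.I • (1 - W)) * V = Complex.I • (1 - G) := by
      rw [mul_smul_comm, smul_mul_assoc, mul_sub, sub_mul, mul_one, hV1]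
    have e2 : star V * (H * (1 + W)) * V = diagonal L * (1 + G) := by
      rw [hspec]
      simp only [← mul_assoc]
      rw [hV1, one_mul, mul_assoc (diagonal L), mul_assoc (diagonal L), mul_add, add_mul, mul_one,
        hV1]
    rw [← e1, ← e2, h1]
  have hdiag : G = diagonal fun i => G i i := by
    ext i j
    by_cases hij : i = j
    · subst hij; simp
    · have h := congrFun (congrFun hLG i) j
      simp only [diagonal_mul, add_apply, sub_apply, smul_apply, one_apply_ne hij, zero_add,
        zero_sub, smul_eq_mul, hL, Function.comp] at h
      have hne : ((hH.eigenvalues i : ℝ) : ℂ) + Complex.I ≠ 0 := by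
        intro h0
        have := congrArg Complex.im h0
        simp at this
      rw [diagonal_apply_ne _ hij]
      refine (mul_eq_zero.mp (?_ : ((hH.eigenvalues i : ℝ) + Complex.I) * G i j = 0)).resolve_left
        hne
      have h' : ((hH.eigenvalues i : ℝ) : ℂ) * G i j = Complex.I * -G i j := h
      linear_combination h'
  refine ⟨V, hVm, fun i => c⁻¹ * G i i, ?_⟩
  have : diagonal (fun i => c⁻¹ * G i i) = c⁻¹ • G := by
    conv_rhs => rw [hdiag]
    rw [← diagonal_smul]; rfl
  rw [this, mul_smul_comm, smul_mul_assoc, ← hWG, hWdef, smul_smul, inv_mul_cancel₀ hc0, one_smul]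

/-- A linear map that sends products to products on a spanning set is multiplicative. -/
theorem LinearMap.map_mul_of_span_eq_top {R A B : Type*} [CommSemiring R] [Semiring A] [Semiring B]
    [Algebra R A] [Algebra R B] (f : A →ₗ[R] B) {s : Set A} (hs : Submodule.span R s = ⊤)
    (h : ∀ x ∈ s, ∀ y ∈ s, f (x * y) = f x * f y) (x y : A) : f (x * y) = f x * f y := by
  have h1 : ∀ x ∈ s, ∀ y, f (x * y) = f x * f y := fun x hx =>
    LinearMap.congr_fun (f := f ∘ₗ LinearMap.mulLeft R x) (g := LinearMap.mulLeft R (f x) ∘ₗ f)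
      (LinearMap.ext_on hs fun y hy => h x hx y hy)
  exact LinearMap.congr_fun (f := f ∘ₗ LinearMap.mulRight R y)
    (g := LinearMap.mulRight R (f y) ∘ₗ f) (LinearMap.ext_on hs fun x hx => h1 x hx y) x

/-- Skolem–Noether for matrix algebras over a field. -/
theorem Matrix.exists_isUnit_mul_eq_mul {K : Type*} [Field K]
    (Φ : Matrix ι ι K ≃ₐ[K] Matrix ι ι K) :
    ∃ P : Matrix ι ι K, IsUnit P ∧ ∀ X, Φ X * P = P * X := by
  obtain ⟨T, hT⟩ := AlgEquiv.eq_linearEquivConjAlgEquiv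
    ((toLinAlgEquiv' (R := K) (n := ι)).symm.trans (Φ.trans toLinAlgEquiv'))
  refine ⟨LinearMap.toMatrix' (T : (ι → K) →ₗ[K] (ι → K)), ?_, fun X => ?_⟩
  · refine IsUnit.of_mul_eq_one (LinearMap.toMatrix' (T.symm : (ι → K) →ₗ[K] (ι → K))) ?_
    rw [← LinearMap.toMatrix'_comp, T.comp_symm, LinearMap.toMatrix'_id]
  · have h := AlgEquiv.congr_fun hT (toLinAlgEquiv' X)
    simp only [AlgEquiv.trans_apply, AlgEquiv.symm_apply_apply] at h
    apply toLin'.injective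
    refine LinearMap.ext fun v => ?_
    have h2 := LinearMap.congr_fun h (T v)
    simp at h2
    simpa [toLin'_mul] using h2

theorem exists_algEquiv_of_trace_eq [Nonempty ι]
    (φ : specialUnitaryGroup ι ℂ ≃* specialUnitaryGroup ι ℂ)
    (htr : ∀ g, trace (φ g : Matrix ι ι ℂ) = trace (g : Matrix ι ι ℂ)) :
    ∃ Φ : Matrix ι ι ℂ ≃ₐ[ℂ] Matrix ι ι ℂ,
      ∀ g : specialUnitaryGroup ι ℂ, Φ g = (φ g : Matrix ι ι ℂ) := by
  let L : (specialUnitaryGroup ι ℂ →₀ ℂ) →ₗ[ℂ] Matrix ι ι ℂ :=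
    Finsupp.linearCombination ℂ fun g => (g : Matrix ι ι ℂ)
  let L' : (specialUnitaryGroup ι ℂ →₀ ℂ) →ₗ[ℂ] Matrix ι ι ℂ :=
    Finsupp.linearCombination ℂ fun g => (φ g : Matrix ι ι ℂ)
  have hspan := span_specialUnitaryGroup (ι := ι)
  have htrL (c) (h : specialUnitaryGroup ι ℂ) :
      trace (L' c * (φ h : Matrix ι ι ℂ)) = trace (L c * (h : Matrix ι ι ℂ)) := by
    refine LinearMap.congr_fun
      (f := traceLinearMap ι ℂ ℂ ∘ₗ LinearMap.mulRight ℂ (φ h : Matrix ι ι ℂ) ∘ₗ L')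
      (g := traceLinearMap ι ℂ ℂ ∘ₗ LinearMap.mulRight ℂ (h : Matrix ι ι ℂ) ∘ₗ L) ?_ c
    refine Finsupp.lhom_ext' fun g => LinearMap.ext_ring ?_
    have := htr (g * h)
    rw [map_mul] at this
    simpa [L, L'] using this
  have hzero (X : Matrix ι ι ℂ)
      (hX : ∀ h : specialUnitaryGroup ι ℂ, trace (X * (h : Matrix ι ι ℂ)) = 0) : X = 0 := by
    rw [ext_iff_trace_mul_right]
    intro Y
    rw [zero_mul, trace_zero]
    exact LinearMap.congr_fun (f := traceLinearMap ι ℂ ℂ ∘ₗ LinearMap.mulLeft ℂ X) (g := 0)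
      (LinearMap.ext_on hspan fun y hy => hX ⟨y, hy⟩) Y
  have hker (c) (hc : L c = 0) : L' c = 0 := hzero _ fun h => by
    obtain ⟨k, rfl⟩ := φ.surjective h
    rw [htrL, hc, zero_mul, trace_zero]
  have hsurj : LinearMap.range L = ⊤ := by
    simp only [L]
    rw [Finsupp.range_linearCombination]
    exact (congrArg (Submodule.span ℂ) Subtype.range_coe).trans hspan
  obtain ⟨s, hs⟩ := L.exists_rightInverse_of_surjective hsurj
  have hLs (X) : L (s X) = X := LinearMap.congr_fun hs X
  let Φ := L' ∘ₗ s
  have hΦ (g : specialUnitaryGroup ι ℂ) : Φ g = (φ g : Matrix ι ι ℂ) := by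
    have h := hker (s g - Finsupp.single g 1) (by simp [hLs, map_sub, L])
    rw [map_sub, sub_eq_zero] at h
    exact h.trans (by simp [L'])
  have hmul := Φ.map_mul_of_span_eq_top hspan fun x hx y hy => by
    have h := hΦ (⟨x, hx⟩ * ⟨y, hy⟩)
    rw [map_mul] at h
    exact h.trans (congrArg₂ (· * ·) (hΦ ⟨x, hx⟩).symm (hΦ ⟨y, hy⟩).symm)
  have hone : Φ 1 = 1 := by
    have h := hΦ 1
    rwa [map_one] at h
  have hinj : Function.Injective Φ := by
    rw [injective_iff_map_eq_zero]
    refine fun X hX => hzero X fun h => ?_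
    rw [← hLs X, ← htrL]
    change trace (Φ X * _) = 0
    rw [hX, zero_mul, trace_zero]
  exact ⟨.ofBijective (AlgHom.ofLinearMap Φ hone hmul)
    ⟨hinj, LinearMap.injective_iff_surjective.mp hinj⟩, hΦ⟩

theorem exists_smul_mem_unitaryGroup_of_conjTranspose_mul_self [Nonempty ι] {P : Matrix ι ι ℂ}
    (hP : IsUnit P) {r : ℂ} (h : star P * P = r • 1) :
    ∃ a : ℂ, a • P ∈ unitaryGroup ι ℂ := by
  obtain ⟨i⟩ := ‹Nonempty ι›
  have hr : r = ((∑ k, ‖P k i‖ ^ 2 : ℝ) : ℂ) := by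
    have h1 := congrFun (congrFun h i) i
    simp only [mul_apply, star_apply, Matrix.smul_apply, one_apply_eq, smul_eq_mul, mul_one] at h1
    rw [← h1]
    push_cast
    exact Finset.sum_congr rfl fun k _ => Complex.conj_mul' _
  set R : ℝ := ∑ k, ‖P k i‖ ^ 2
  have hR0 : R ≠ 0 := by
    intro h0
    have : star P * P = 0 := by rw [h, hr, h0]; simp
    have hu : IsUnit (star P * P) := hP.star.mul hP
    rw [this] at hu
    have : Nontrivial (Matrix ι ι ℂ) := ⟨⟨0, 1, fun h => by simpa using congrFun (congrFun h i) i⟩⟩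
    exact not_isUnit_zero hu
  have hRpos : 0 < R := lt_of_le_of_ne (Finset.sum_nonneg fun k _ => by positivity) hR0.symm
  refine ⟨((√R)⁻¹ : ℝ), ?_⟩
  rw [mem_unitaryGroup_iff', star_smul, smul_mul_smul_comm, h, hr, smul_smul]
  have : star (((√R)⁻¹ : ℝ) : ℂ) * (((√R)⁻¹ : ℝ) : ℂ) * (R : ℂ) = 1 := by
    rw [Complex.star_def, Complex.conj_ofReal]
    norm_cast
    rw [← mul_inv, Real.mul_self_sqrt hRpos.le, inv_mul_cancel₀ hR0]
  rw [this, one_smul]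

/-- An automorphism of the special unitary group preserving traces is inner. -/
theorem exists_conj_of_trace_eq [Nonempty ι]
    (φ : specialUnitaryGroup ι ℂ ≃* specialUnitaryGroup ι ℂ)
    (htr : ∀ g, trace (φ g : Matrix ι ι ℂ) = trace (g : Matrix ι ι ℂ)) :
    ∃ h ∈ specialUnitaryGroup ι ℂ, ∀ g : specialUnitaryGroup ι ℂ,
      (φ g : Matrix ι ι ℂ) = h * (g : Matrix ι ι ℂ) * h⁻¹ := by
  obtain ⟨Φ, hΦ⟩ := exists_algEquiv_of_trace_eq φ htr
  obtain ⟨P, hP, hPΦ⟩ := exists_isUnit_mul_eq_mul Φ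
  have hint (g : specialUnitaryGroup ι ℂ) :
      (φ g : Matrix ι ι ℂ) * P = P * (g : Matrix ι ι ℂ) := by rw [← hΦ, hPΦ]
  have hcomm (g : specialUnitaryGroup ι ℂ) :
      (g : Matrix ι ι ℂ) * (star P * P) = star P * P * (g : Matrix ι ι ℂ) := by
    have hg : (g : Matrix ι ι ℂ) * star (g : Matrix ι ι ℂ) = 1 := g.2.1.2
    have hφg : star (φ g : Matrix ι ι ℂ) * (φ g : Matrix ι ι ℂ) = 1 := (φ g).2.1.1
    have h1 : star P * P = star (g : Matrix ι ι ℂ) * (star P * P) * (g : Matrix ι ι ℂ) := by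
      have h2 : star ((φ g : Matrix ι ι ℂ) * P) * ((φ g : Matrix ι ι ℂ) * P) = star P * P := by
        rw [star_mul, mul_assoc, ← mul_assoc (star (φ g : Matrix ι ι ℂ)), hφg, one_mul]
      rw [hint, star_mul] at h2
      exact h2.symm.trans (by simp only [mul_assoc])
    conv_lhs => rw [h1]
    rw [← mul_assoc, ← mul_assoc, hg, one_mul]
  have hcenter : star P * P ∈ Set.center (Matrix ι ι ℂ) := by
    rw [Semigroup.mem_center_iff]
    intro X
    exact LinearMap.congr_fun (f := LinearMap.mulRight ℂ (star P * P))
      (g := LinearMap.mulLeft ℂ (star P * P))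
      (LinearMap.ext_on span_specialUnitaryGroup fun y hy => hcomm ⟨y, hy⟩) X
  rw [center_eq_range] at hcenter
  obtain ⟨r, hr⟩ := hcenter
  obtain ⟨a, haP⟩ := exists_smul_mem_unitaryGroup_of_conjTranspose_mul_self (r := r) hP
    (by rw [← hr, scalar_apply, smul_one_eq_diagonal])
  obtain ⟨c, -, hcP⟩ := exists_smul_mem_specialUnitaryGroup haP
  refine ⟨_, hcP, fun g => ?_⟩
  have hdet : IsUnit (det (c • a • P)) := by
    rw [(mem_specialUnitaryGroup_iff.mp hcP).2]; exact isUnit_one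
  have h : c • a • P * (g : Matrix ι ι ℂ) = (φ g : Matrix ι ι ℂ) * c • a • P := by
    simp only [smul_mul_assoc, mul_smul_comm, hint]
  rw [h, mul_nonsing_inv_cancel_right _ _ hdet]

/-- Commuting unitary matrices have a common eigenbasis. -/
theorem Matrix.exists_basis_eigenvector_of_commute {α : Type*} {ρ : α → Matrix ι ι ℂ}
    (hρ : ∀ x, ρ x ∈ unitaryGroup ι ℂ) (hcomm : ∀ x y, Commute (ρ x) (ρ y)) :
    ∃ (b : Module.Basis ι ℂ (ι → ℂ)) (χ : ι → α → ℂ), ∀ i x, ρ x *ᵥ b i = χ i x • b i := by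
  have h1 (x) : star (ρ x) * ρ x = 1 := (hρ x).1
  have h2 (x) : ρ x * star (ρ x) = 1 := (hρ x).2
  have hcs (x y) : Commute (ρ x) (star (ρ y)) := by
    calc ρ x * star (ρ y) = star (ρ y) * (ρ y * ρ x) * star (ρ y) := by
          rw [← mul_assoc, h1, one_mul]
      _ = star (ρ y) * ρ x := by
          rw [← (hcomm x y).eq, mul_assoc, mul_assoc, h2, mul_one]
  have hss (x y) : Commute (star (ρ x)) (star (ρ y)) := (hcomm x y).star_star
  let A : α × Bool → Matrix ι ι ℂ := fun p =>
    if p.2 then ρ p.1 + star (ρ p.1) else Complex.I • (ρ p.1 - star (ρ p.1))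
  have hA (p) : (A p).IsHermitian := by
    obtain ⟨x, _ | _⟩ := p
    · change star (Complex.I • (ρ x - star (ρ x))) = _
      simp [A, ← smul_neg]
    · change star (ρ x + star (ρ x)) = _
      simp [A, add_comm]
  have hAc (p q) : Commute (A p) (A q) := by
    have e (x y) : Commute (ρ x) (ρ y) ∧ Commute (ρ x) (star (ρ y)) ∧
      Commute (star (ρ x)) (ρ y) ∧ Commute (star (ρ x)) (star (ρ y)) :=
      ⟨hcomm x y, hcs x y, (hcs y x).symm, hss x y⟩
    obtain ⟨x, _ | _⟩ := p <;> obtain ⟨y, _ | _⟩ := q <;>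
    obtain ⟨e1, e2, e3, e4⟩ := e x y <;> simp only [A, Bool.false_eq_true, if_true, if_false]
    · exact ((((e1.sub_right e2).sub_left (e3.sub_right e4)).smul_left _).smul_right _)
    · exact (((e1.add_right e2).sub_left (e3.add_right e4)).smul_left _)
    · exact (((e1.sub_right e2).add_left (e3.sub_right e4)).smul_right _)
    · exact ((e1.add_right e2).add_left (e3.add_right e4))
  have htop := LinearMap.IsSymmetric.iSup_iInf_eq_top_of_commute
    (T := fun p => toEuclideanLin (A p)) (fun p => isSymmetric_toEuclideanLin_iff.mpr (hA p))
    (fun p q _ => by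
      refine LinearMap.ext fun v => ?_
      have := (hAc p q).eq
      simp [Module.End.mul_apply, toLpLin_apply, this])
  let E : Set (ι → ℂ) := {v | ∃ χ : α → ℂ, ∀ x, ρ x *ᵥ v = χ x • v}
  have hE : ⊤ ≤ Submodule.span ℂ E := by
    have hmap : Submodule.map (WithLp.linearEquiv 2 ℂ (ι → ℂ)).toLinearMap ⊤ = ⊤ := by
      rw [Submodule.map_top, LinearEquiv.range]
    rw [← hmap, ← htop, Submodule.map_iSup]
    refine iSup_le fun χ => ?_
    rintro _ ⟨v, hv, rfl⟩
    refine Submodule.subset_span ⟨fun x => (χ (x, true) - Complex.I * χ (x, false)) / 2,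
      fun x => ?_⟩
    rw [SetLike.mem_coe, Submodule.mem_iInf] at hv
    have ht := Module.End.mem_eigenspace_iff.mp (hv (x, true))
    have hf := Module.End.mem_eigenspace_iff.mp (hv (x, false))
    replace ht := congrArg WithLp.ofLp ht
    replace hf := congrArg WithLp.ofLp hf
    simp only [A, toLpLin_apply, if_true, Bool.false_eq_true, if_false, WithLp.ofLp_smul] at ht hf
    change ρ x *ᵥ v.ofLp = _ • v.ofLp
    have hρx : ρ x = (1 / 2 : ℂ) • ((ρ x + star (ρ x)) -
        Complex.I • (Complex.I • (ρ x - star (ρ x)))) := by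
      rw [smul_smul, Complex.I_mul_I]; module
    rw [hρx, smul_mulVec, sub_mulVec, smul_mulVec Complex.I, ht, hf]
    module
  let b₀ := Module.Basis.ofSpan hE
  have hb₀ (i) : b₀ i ∈ E := Module.Basis.ofSpan_subset hE ⟨i, rfl⟩
  let e := b₀.indexEquiv (Pi.basisFun ℂ ι)
  choose χ hχ using hb₀
  exact ⟨b₀.reindex e, fun i => χ (e.symm i), fun i x => by
    rw [Module.Basis.reindex_apply]; exact hχ _ x⟩

open scoped ComplexOrder in
theorem Matrix.norm_eq_one_of_mulVec_eq_smul {U : Matrix ι ι ℂ} (hU : U ∈ unitaryGroup ι ℂ)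
    {v : ι → ℂ} (hv : v ≠ 0) {c : ℂ} (h : U *ᵥ v = c • v) : ‖c‖ = 1 := by
  have h1 : star (U *ᵥ v) ⬝ᵥ (U *ᵥ v) = star v ⬝ᵥ v := by
    rw [star_mulVec, ← dotProduct_mulVec, mulVec_mulVec, ← star_eq_conjTranspose, hU.1,
      one_mulVec]
  have hvv : star v ⬝ᵥ v ≠ 0 := (not_congr dotProduct_star_self_eq_zero).mpr hv
  rw [h, star_smul, smul_dotProduct, dotProduct_smul, smul_smul, smul_eq_mul] at h1
  have h2 := (mul_eq_right₀ hvv).mp h1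
  have h3 : (‖c‖ : ℂ) ^ 2 = 1 := by rw [← h2]; exact (Complex.conj_mul' c).symm
  have h4 : ‖c‖ ^ 2 = 1 := by exact_mod_cast h3
  exact (pow_eq_one_iff_of_nonneg (norm_nonneg c) two_ne_zero).mp h4

/-- A continuous unitary representation of `ℝ^ι` on `ℂ^ι` is a direct sum of characters. -/
theorem exists_basis_weights {κ : Type*} [Fintype κ] {ρ : (κ → ℝ) → Matrix ι ι ℂ}
    (hρ : ∀ x, ρ x ∈ unitaryGroup ι ℂ) (hcont : Continuous ρ)
    (hadd : ∀ x y, ρ (x + y) = ρ x * ρ y) :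
    ∃ (b : Module.Basis ι ℂ (ι → ℂ)) (m : ι → κ → ℝ), ∀ i x,
      ρ x *ᵥ b i = Complex.exp ((∑ k, m i k * x k : ℝ) * Complex.I) • b i := by
  classical
  obtain ⟨b, χ, hχ⟩ := exists_basis_eigenvector_of_commute hρ
    (fun x y => by rw [commute_iff_eq, ← hadd, ← hadd, add_comm])
  have hnorm (i x) : ‖χ i x‖ = 1 := norm_eq_one_of_mulVec_eq_smul (hρ x) (b.ne_zero i) (hχ i x)
  have hχadd (i x y) : χ i (x + y) = χ i x * χ i y := by
    have h := hχ i (x + y)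
    rw [hadd, ← mulVec_mulVec, hχ, mulVec_smul, hχ, smul_smul] at h
    rw [mul_comm]
    exact (smul_left_injective ℂ (b.ne_zero i) h).symm
  have hχcont (i) : Continuous (χ i) := by
    obtain ⟨k, hk⟩ := Function.ne_iff.mp (b.ne_zero i)
    have h (x) : χ i x = (ρ x *ᵥ b i) k / b i k := by
      rw [hχ, Pi.smul_apply, smul_eq_mul, mul_div_cancel_right₀ _ hk]
    rw [funext h]
    exact ((continuous_apply k).comp (hcont.matrix_mulVec continuous_const)).div_const _
  have hsingle (i) (k : κ) : ∃ m : ℝ, ∀ s : ℝ,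
      χ i (Pi.single k s) = Complex.exp ((m * s : ℝ) * Complex.I) :=
    exists_eq_cexp_mul_I (f := fun s => χ i (Pi.single k s))
      ((hχcont i).comp (continuous_single (A := fun _ : κ => ℝ) k))
      (fun x y => by rw [Pi.single_add, hχadd]) (fun x => hnorm i _)
  choose m hm using hsingle
  refine ⟨b, m, fun i x => ?_⟩
  rw [hχ]
  congr 1
  have hχ0 : χ i 0 = 1 := by
    have h := hχadd i 0 0
    rw [add_zero] at h
    have hne : χ i 0 ≠ 0 := fun h' => by simpa [h'] using hnorm i 0
    exact (mul_eq_left₀ hne).mp h.symm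
  let X : Multiplicative (κ → ℝ) →* ℂ :=
    { toFun := fun x => χ i x.toAdd, map_one' := hχ0, map_mul' := fun x y => hχadd i _ _ }
  have hX : χ i x = ∏ k, χ i (Pi.single k (x k)) := by
    have h := map_prod X (fun k => Multiplicative.ofAdd (Pi.single k (x k) : κ → ℝ)) Finset.univ
    rw [← ofAdd_sum, Finset.univ_sum_single] at h
    exact h
  rw [hX, Complex.ofReal_sum, Finset.sum_mul, Complex.exp_sum]
  exact Finset.prod_congr rfl fun k _ => hm i k _

/-- The trace of a matrix is the sum of its eigenvalues along an eigenbasis. -/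
theorem Matrix.trace_eq_sum_of_mulVec_basis {K : Type*} [Field K] {A : Matrix ι ι K}
    (b : Module.Basis ι K (ι → K)) {d : ι → K} (h : ∀ i, A *ᵥ b i = d i • b i) :
    trace A = ∑ i, d i := by
  rw [← trace_toLin'_eq, LinearMap.trace_eq_matrix_trace K b]
  simp [trace, LinearMap.toMatrix_apply, h]

theorem Matrix.eq_one_of_mulVec_basis {K : Type*} [Field K] {A : Matrix ι ι K}
    (b : Module.Basis ι K (ι → K)) (h : ∀ i, A *ᵥ b i = b i) : A = 1 := by
  apply toLin'.injective
  exact b.ext fun i => by simp [h]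

theorem Finset.card_add_one_le_of_comp_swap_mem {X : Type*} [DecidableEq X] {f : ι → X}
    {W : Finset (ι → X)} (hf : f ∈ W) (hW : ∀ j k, f ∘ Equiv.swap j k ∈ W) {E : Finset (ι × ι)}
    (hE : ∀ p ∈ E, f p.1 ≠ f p.2) (hswap : ∀ p ∈ E, p.swap ∉ E) :
    E.card + 1 ≤ W.card := by
  rw [← Finset.card_erase_add_one hf]
  refine Nat.succ_le_succ (Finset.card_le_card_of_injOn (fun p => f ∘ Equiv.swap p.1 p.2) ?_ ?_)
  · intro p hp
    simp only [Finset.coe_erase, Set.mem_sdiff, Finset.mem_coe, hW, Set.mem_singleton_iff, true_and]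
    intro h
    exact hE p hp (by simpa using (congrFun h p.1).symm)
  · rintro ⟨i, j⟩ hp ⟨k, l⟩ hq h
    have hij := hE _ hp
    have hi := congrFun h i
    have hj := congrFun h j
    have hs := hswap _ hp
    simp only [Function.comp, Equiv.swap_apply_left, Equiv.swap_apply_right, Prod.swap_prod_mk,
      Finset.mem_coe] at *
    have hi' : i = k ∨ i = l := by
      by_contra! hc
      rw [Equiv.swap_apply_of_ne_of_ne hc.1 hc.2] at hi
      exact hij hi.symm
    have hj' : j = k ∨ j = l := by
      by_contra! hc
      rw [Equiv.swap_apply_of_ne_of_ne hc.1 hc.2] at hj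
      exact hij hj
    rcases hi' with rfl | rfl <;> rcases hj' with rfl | rfl
    · exact absurd rfl hij
    · rfl
    · exact absurd hq hs
    · exact absurd rfl hij

/-- If a nonconstant function has at most as many translates under transpositions as there are
points, then it is constant off a single point. -/
theorem exists_eq_update_of_comp_swap_mem {X : Type*} {f : ι → X} (hf : ∃ p q, f p ≠ f q)
    {W : Finset (ι → X)} (hfW : f ∈ W) (hW : ∀ j k, f ∘ Equiv.swap j k ∈ W)
    (hcard : W.card ≤ Fintype.card ι) :
    ∃ i a b, a ≠ b ∧ f = Function.update (fun _ => b) i a := by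
  classical
  suffices h : ∃ i, ∀ j k, j ≠ i → k ≠ i → f j = f k by
    obtain ⟨i, hi⟩ := h
    obtain ⟨q, hqi⟩ : ∃ q, f q ≠ f i := by
      by_contra! h
      obtain ⟨p, q, hpq⟩ := hf
      exact hpq ((h p).trans (h q).symm)
    refine ⟨i, f i, f q, hqi.symm, funext fun j => ?_⟩
    by_cases hj : j = i
    · subst hj; simp
    · rw [Function.update_of_ne hj]
      exact hi j q hj fun h => hqi (h ▸ rfl)
  by_contra! hno
  obtain ⟨p, q, hpq⟩ := hf
  set A : Finset ι := Finset.univ.filter fun l => f l = f p with hA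
  have hmemA (l) : l ∈ A ↔ f l = f p := by simp [hA]
  have hpA : p ∈ A := by simp [hA]
  have hqA : q ∈ Aᶜ := by simpa [hA] using hpq.symm
  have hsum : A.card + Aᶜ.card = Fintype.card ι := Finset.card_add_card_compl A
  have hE (r) (hr : r ∈ A ×ˢ Aᶜ) : f r.1 ≠ f r.2 := by
    simp only [Finset.mem_product, Finset.mem_compl, hmemA] at hr
    exact fun h => hr.2 (h ▸ hr.1)
  have hA2 : A.card ≠ 1 := by
    intro h1
    obtain ⟨j, k, hj, hk, hjk⟩ := hno p
    obtain ⟨x, hx⟩ := Finset.card_eq_one.mp h1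
    have hAp (l) : l ∈ A ↔ l = p := by
      rw [hx, Finset.mem_singleton] at hpA
      rw [hx, Finset.mem_singleton, hpA]
    have hjkA : (j, k) ∉ A ×ˢ Aᶜ := by simp [hAp, hj]
    have := Finset.card_add_one_le_of_comp_swap_mem hfW hW (E := insert (j, k) (A ×ˢ Aᶜ))
      (by
        intro r hr
        rcases Finset.mem_insert.mp hr with rfl | hr
        · exact hjk
        · exact hE r hr)
      (by
        rintro ⟨u, v⟩ hr
        simp only [Finset.mem_insert, Finset.mem_product, Finset.mem_compl, hAp, Prod.swap_prod_mk,
          Prod.mk.injEq] at hr ⊢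
        rintro (h | h) <;> rcases hr with hr | hr
        · exact hjk (by rw [← hr.1, h.2])
        · exact hk (by rw [← h.2, hr.1])
        · exact hk (by rw [← hr.2, h.1])
        · exact h.2 hr.1)
    rw [Finset.card_insert_of_notMem hjkA, Finset.card_product, h1] at this
    omega
  have hAc2 : Aᶜ.card ≠ 1 := by
    intro h1
    obtain ⟨x, hx⟩ := Finset.card_eq_one.mp h1
    obtain ⟨j, k, hj, hk, hjk⟩ := hno x
    have hl (l) (hl : l ≠ x) : f l = f p := by
      rw [← hmemA]
      by_contra h
      rw [← Finset.mem_compl, hx, Finset.mem_singleton] at h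
      exact hl h
    exact hjk ((hl j hj).trans (hl k hk).symm)
  have h := Finset.card_add_one_le_of_comp_swap_mem hfW hW hE (by
    rintro ⟨u, v⟩ hr
    simp only [Finset.mem_product, Finset.mem_compl, Prod.swap_prod_mk] at hr ⊢
    exact fun h => h.2 hr.1)
  rw [Finset.card_product] at h
  have h1 : 2 ≤ A.card := by
    have := Finset.card_pos.mpr ⟨p, hpA⟩; omega
  have h2 : 2 ≤ Aᶜ.card := by
    have := Finset.card_pos.mpr ⟨q, hqA⟩; omega
  nlinarith

/-- A family of `|ι|` functions on `ι` which is stable under transpositions and has a nonconstant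
member consists exactly of the functions taking a value `a` at one point and `b` elsewhere. -/
theorem exists_bijective_eq_update {X : Type*} {m : ι → ι → X}
    (hswap : ∀ i j k, ∃ l, m l = m i ∘ Equiv.swap j k) (hm : ∃ i p q, m i p ≠ m i q) :
    ∃ a b, a ≠ b ∧ ∃ e : ι → ι, Function.Bijective e ∧
      ∀ j, m (e j) = Function.update (fun _ => b) j a := by
  classical
  obtain ⟨i₀, hi₀⟩ := hm
  obtain ⟨i, a, b, hab, hi⟩ := exists_eq_update_of_comp_swap_mem hi₀ (W := Finset.univ.image m)
    (by simp) (fun j k => by simpa using hswap i₀ j k) Finset.card_image_le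
  have hex (j) : ∃ l, m l = Function.update (fun _ => b) j a := by
    obtain ⟨l, hl⟩ := hswap i₀ i j
    refine ⟨l, hl.trans (hi ▸ funext fun x => ?_)⟩
    by_cases hx : x = j
    · subst hx; simp
    · rw [Function.comp, Function.update_of_ne hx, Function.update_of_ne]
      rw [ne_eq, Equiv.swap_apply_eq_iff, Equiv.swap_apply_left]
      exact hx
  choose e he using hex
  refine ⟨a, b, hab, e, Finite.injective_iff_bijective.mp fun j k hjk => ?_, he⟩
  have h := congrFun ((he j).symm.trans ((congrArg m hjk).trans (he k))) j
  by_contra hne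
  rw [Function.update_self, Function.update_of_ne hne] at h
  exact hab h

theorem Matrix.diagonal_mem_unitaryGroup_iff {d : ι → ℂ} :
    diagonal d ∈ unitaryGroup ι ℂ ↔ ∀ i, ‖d i‖ = 1 := by
  rw [mem_unitaryGroup_iff', star_eq_conjTranspose, diagonal_conjTranspose, diagonal_mul_diagonal,
    diagonal_eq_one, funext_iff]
  refine forall_congr' fun i => ?_
  rw [Pi.star_apply, Complex.star_def, Complex.conj_mul', Pi.one_apply]
  norm_cast
  exact pow_eq_one_iff_of_nonneg (norm_nonneg _) two_ne_zero

/-- The homomorphism from `ℝ^ι` onto the diagonal torus of the special unitary group, obtained by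
projecting to the vectors of sum zero and exponentiating. -/
noncomputable def Matrix.diagonalTorus [Nonempty ι] (x : ι → ℝ) : specialUnitaryGroup ι ℂ :=
  ⟨diagonal fun j => Complex.exp ((x j - (∑ k, x k) / Fintype.card ι : ℝ) * Complex.I),
    diagonal_mem_unitaryGroup_iff.mpr fun _ => Complex.norm_exp_ofReal_mul_I _, by
      change det _ = 1
      rw [det_diagonal, cexp_sum_sub_mean_mul_I]⟩

section diagonalTorus

variable [Nonempty ι]

theorem Matrix.coe_diagonalTorus {x : ι → ℝ} (hx : ∑ k, x k = 0) :
    (diagonalTorus x : Matrix ι ι ℂ) = diagonal fun j => Complex.exp (x j * Complex.I) := by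
  simp [diagonalTorus, hx]

theorem Matrix.diagonalTorus_add (x y : ι → ℝ) :
    diagonalTorus (x + y) = diagonalTorus x * diagonalTorus y := by
  refine Subtype.ext ?_
  simp only [diagonalTorus, Submonoid.coe_mul, diagonal_mul_diagonal, ← Complex.exp_add]
  congr 1
  funext j
  congr 1
  simp only [Pi.add_apply, Finset.sum_add_distrib]
  push_cast
  ring

theorem Matrix.continuous_diagonalTorus :
    Continuous (diagonalTorus : (ι → ℝ) → specialUnitaryGroup ι ℂ) := by
  refine Continuous.subtype_mk (Continuous.matrix_diagonal ?_) _
  fun_prop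

/-- Conjugation by a suitable determinant-one multiple of a permutation matrix permutes the
coordinates of the diagonal torus. -/
theorem Matrix.exists_mul_diagonalTorus (σ : Equiv.Perm ι) :
    ∃ S : specialUnitaryGroup ι ℂ, ∀ x : ι → ℝ,
      S * diagonalTorus x = diagonalTorus (x ∘ σ) * S := by
  have hσ : σ.permMatrix ℂ ∈ unitaryGroup ι ℂ := by
    rw [mem_unitaryGroup_iff', star_eq_conjTranspose, conjTranspose_permMatrix, ← permMatrix_mul,
      mul_inv_cancel, permMatrix_one]
  obtain ⟨c, -, hc⟩ := exists_smul_mem_specialUnitaryGroup hσ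
  refine ⟨⟨_, hc⟩, fun x => Subtype.ext ?_⟩
  simp only [Submonoid.coe_mul, smul_mul_assoc, mul_smul_comm, diagonalTorus, Function.comp]
  rw [Equiv.sum_comp σ x]
  congr 1
  ext i j
  rw [Equiv.Perm.permMatrix, PEquiv.toMatrix_toPEquiv_mul, PEquiv.mul_toMatrix_toPEquiv]
  simp [diagonal_apply, Equiv.eq_symm_apply]

theorem Matrix.trace_diagonalTorus {x : ι → ℝ} (hx : ∑ k, x k = 0) :
    trace (diagonalTorus x : Matrix ι ι ℂ) = ∑ j, Complex.exp (x j * Complex.I) := by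
  rw [coe_diagonalTorus hx, trace_diagonal]

theorem Matrix.exists_eq_diagonalTorus {d : ι → ℂ} (hd : ∀ i, ‖d i‖ = 1) (hprod : ∏ i, d i = 1) :
    ∃ x : ι → ℝ, ∑ k, x k = 0 ∧ diagonal d = (diagonalTorus x : Matrix ι ι ℂ) := by
  obtain ⟨i₀⟩ := ‹Nonempty ι›
  have hd' (i) : Complex.exp ((d i).arg * Complex.I) = d i := by
    simpa [hd] using Complex.norm_mul_exp_arg_mul_I (d i)
  set s : ℝ := ∑ i, (d i).arg with hs
  have hexp : Complex.exp (s * Complex.I) = 1 := by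
    rw [hs, Complex.ofReal_sum, Finset.sum_mul, Complex.exp_sum, ← hprod]
    exact Finset.prod_congr rfl fun i _ => hd' i
  have hsum : ∑ k, ((fun i => (d i).arg) - Pi.single i₀ s : ι → ℝ) k = 0 := by
    simp [hs]
  refine ⟨_, hsum, ?_⟩
  rw [coe_diagonalTorus hsum]
  congr 1
  funext j
  by_cases hj : j = i₀
  · subst hj
    simp [sub_mul, Complex.exp_sub, hexp, hd']
  · simp [hj, hd']

/-- The diagonal torus meets every conjugacy class of the special unitary group. -/
theorem Matrix.exists_eq_conj_diagonalTorus (g : specialUnitaryGroup ι ℂ) :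
    ∃ (h : specialUnitaryGroup ι ℂ) (x : ι → ℝ), ∑ k, x k = 0 ∧ g = h * diagonalTorus x * h⁻¹ := by
  obtain ⟨V, hV, d, hd⟩ := exists_diagonal_of_mem_unitaryGroup g.2.1
  obtain ⟨c, hc, hcV⟩ := exists_smul_mem_specialUnitaryGroup hV
  set W : specialUnitaryGroup ι ℂ := ⟨c • V, hcV⟩ with hW
  have hg : (g : Matrix ι ι ℂ) = W * diagonal d * star (W : Matrix ι ι ℂ) := by
    have : star c * c = 1 := by rw [Complex.star_def, Complex.conj_mul', hc]; simp
    rw [hW, hd, star_smul, smul_mul_assoc, mul_smul_comm, smul_mul_assoc, smul_smul, this, one_smul]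
  have hW1 : star (W : Matrix ι ι ℂ) * W = 1 := W.2.1.1
  have hdg : diagonal d = ((W⁻¹ * g * W : specialUnitaryGroup ι ℂ) : Matrix ι ι ℂ) := by
    change _ = star (W : Matrix ι ι ℂ) * g * W
    rw [hg, ← mul_assoc, ← mul_assoc, hW1, one_mul, mul_assoc, hW1, mul_one]
  have hmem : diagonal d ∈ specialUnitaryGroup ι ℂ := hdg ▸ (W⁻¹ * g * W).2
  have hdet := (mem_specialUnitaryGroup_iff.mp hmem).2
  rw [det_diagonal] at hdet
  obtain ⟨x, hx, hdx⟩ := exists_eq_diagonalTorus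
    (diagonal_mem_unitaryGroup_iff.mp hmem.1) hdet
  refine ⟨W, x, hx, ?_⟩
  rw [← Subtype.ext (hdg.symm.trans hdx)]
  group

theorem Matrix.trace_map_eq_trace_map_diagonalTorus
    (φ : specialUnitaryGroup ι ℂ →* specialUnitaryGroup ι ℂ) (h : specialUnitaryGroup ι ℂ)
    (x : ι → ℝ) : trace (φ (h * diagonalTorus x * h⁻¹) : Matrix ι ι ℂ) =
      trace (φ (diagonalTorus x) : Matrix ι ι ℂ) := by
  have h1 : ((φ h)⁻¹ * φ h : specialUnitaryGroup ι ℂ) = 1 := inv_mul_cancel _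
  rw [map_mul, map_mul, map_inv, Submonoid.coe_mul, trace_mul_comm, ← Submonoid.coe_mul,
    ← mul_assoc, h1, one_mul]

end diagonalTorus

theorem eq_of_forall_cexp_mul_I_eq {a b : ℝ}
    (h : ∀ s : ℝ, Complex.exp ((a * s : ℝ) * Complex.I) = Complex.exp ((b * s : ℝ) * Complex.I)) :
    a = b := by
  by_contra hab
  have hne : a - b ≠ 0 := sub_ne_zero.mpr hab
  have h1 := h (Real.pi / (a - b))
  have h2 : Complex.exp (Real.pi * Complex.I) = 1 := by
    have e : (Real.pi : ℂ) * Complex.I = (a * (Real.pi / (a - b)) : ℝ) * Complex.I -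
        (b * (Real.pi / (a - b)) : ℝ) * Complex.I := by
      rw [← sub_mul, ← Complex.ofReal_sub, ← sub_mul, mul_div_cancel₀ _ hne]
    rw [e, Complex.exp_sub, h1, div_self (Complex.exp_ne_zero _)]
  rw [Complex.exp_pi_mul_I] at h2
  norm_num at h2

/-- A continuous injective endomorphism of the special unitary group acts on the diagonal torus,
in a suitable basis, by scaling the angles. -/
theorem exists_basis_map_diagonalTorus [Nontrivial ι]
    (φ : specialUnitaryGroup ι ℂ →* specialUnitaryGroup ι ℂ) (hφ : Continuous φ)
    (hinj : Function.Injective φ) :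
    ∃ (b : Module.Basis ι ℂ (ι → ℂ)) (c : ℝ), c ≠ 0 ∧ ∀ x : ι → ℝ, ∑ k, x k = 0 → ∀ j,
      (φ (diagonalTorus x) : Matrix ι ι ℂ) *ᵥ b j =
        Complex.exp ((c * x j : ℝ) * Complex.I) • b j := by
  obtain ⟨b, m, hm⟩ := exists_basis_weights (ρ := fun x => (φ (diagonalTorus x) : Matrix ι ι ℂ))
    (fun x => (φ (diagonalTorus x)).2.1)
    (continuous_subtype_val.comp (hφ.comp continuous_diagonalTorus))
    (fun x y => by rw [diagonalTorus_add, map_mul, Submonoid.coe_mul])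
  have hswap (i j k) : ∃ l, m l = m i ∘ Equiv.swap j k := by
    set σ := Equiv.swap j k
    have hσσ (y : ι → ℝ) : (y ∘ σ) ∘ σ = y := funext fun t => by simp [σ]
    obtain ⟨S, hS⟩ := exists_mul_diagonalTorus σ
    set w := (φ S : Matrix ι ι ℂ) *ᵥ b i with hw
    have hwy (y : ι → ℝ) : (φ (diagonalTorus y) : Matrix ι ι ℂ) *ᵥ w =
        Complex.exp ((∑ t, m i (σ t) * y t : ℝ) * Complex.I) • w := by
      have h := congrArg φ (hS (y ∘ σ))
      rw [hσσ, map_mul, map_mul] at h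
      have h' := congrArg Subtype.val h
      rw [Submonoid.coe_mul, Submonoid.coe_mul] at h'
      rw [hw, mulVec_mulVec, ← h', ← mulVec_mulVec, hm, mulVec_smul]
      congr 4
      rw [← Equiv.sum_comp σ]
      simp [σ]
    have hw0 : w ≠ 0 := by
      intro h0
      have h1 : (star (φ S : Matrix ι ι ℂ)) * (φ S : Matrix ι ι ℂ) = 1 := (φ S).2.1.1
      refine b.ne_zero i ?_
      rw [← one_mulVec (b i), ← h1, ← mulVec_mulVec, ← hw, h0, mulVec_zero]
    obtain ⟨l, hl⟩ : ∃ l, b.repr w l ≠ 0 := by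
      by_contra! h
      exact hw0 (b.repr.map_eq_zero_iff.mp (Finsupp.ext h))
    have hrepr (y : ι → ℝ) (v : ι → ℂ) :
        b.repr ((φ (diagonalTorus y) : Matrix ι ι ℂ) *ᵥ v) l =
          Complex.exp ((∑ t, m l t * y t : ℝ) * Complex.I) * b.repr v l := by
      refine LinearMap.congr_fun
        (f := b.coord l ∘ₗ toLin' (φ (diagonalTorus y) : Matrix ι ι ℂ))
        (g := Complex.exp ((∑ t, m l t * y t : ℝ) * Complex.I) • b.coord l)
        (b.ext fun t => ?_) v
      by_cases htl : t = l
      · subst htl; simp [hm]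
      · simp [hm, htl]
    refine ⟨l, funext fun t => eq_of_forall_cexp_mul_I_eq fun s => ?_⟩
    have h := hrepr (Pi.single t s) w
    rw [hwy, map_smul, Finsupp.smul_apply, smul_eq_mul] at h
    have h2 := mul_right_cancel₀ hl h
    simpa [Pi.single_apply] using h2.symm
  have hnonconst : ∃ i p q, m i p ≠ m i q := by
    by_contra! hconst
    obtain ⟨p, q, hpq⟩ := exists_pair_ne ι
    set x : ι → ℝ := Pi.single p Real.pi - Pi.single q Real.pi
    have hx : ∑ k, x k = 0 := by simp [x]
    have h1 : φ (diagonalTorus x) = 1 := by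
      refine Subtype.ext (eq_one_of_mulVec_basis b fun i => ?_)
      rw [hm, Finset.sum_congr rfl fun k _ => congrArg (· * x k) (hconst i k p), ← Finset.mul_sum,
        hx]
      simp
    have h2 := congrArg Subtype.val (hinj (h1.trans (map_one φ).symm))
    rw [coe_diagonalTorus hx] at h2
    have h3 := congrFun (congrFun h2 p) p
    simp only [diagonal_apply_eq, x, Pi.sub_apply, Pi.single_eq_same, Pi.single_eq_of_ne hpq,
      sub_zero, Complex.exp_pi_mul_I, Submonoid.coe_one, one_apply_eq] at h3
    norm_num at h3
  obtain ⟨a, a', haa', e, he, hme⟩ := exists_bijective_eq_update hswap hnonconst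
  refine ⟨b.reindex (Equiv.ofBijective e he).symm, a - a', sub_ne_zero.mpr haa', fun x hx j => ?_⟩
  rw [Module.Basis.reindex_apply, Equiv.symm_symm, Equiv.ofBijective_apply, hm, hme]
  congr 4
  have hupd (t) : Function.update (fun _ => a') j a t * x t =
      a' * x t + Pi.single (M := fun _ => ℝ) j ((a - a') * x j) t := by
    by_cases ht : t = j
    · subst ht; simp; ring
    · simp [ht]
  simp only [hupd, Finset.sum_add_distrib, ← Finset.mul_sum, hx, Finset.sum_pi_single']
  simp

/-- The scaling factor of `exists_basis_map_diagonalTorus` is `1` or `-1`. -/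
theorem exists_basis_map_diagonalTorus_sign [Nontrivial ι]
    (φ : specialUnitaryGroup ι ℂ →* specialUnitaryGroup ι ℂ) (hφ : Continuous φ)
    (hinj : Function.Injective φ) :
    ∃ (b : Module.Basis ι ℂ (ι → ℂ)) (c : ℝ), (c = 1 ∨ c = -1) ∧
      ∀ x : ι → ℝ, ∑ k, x k = 0 → ∀ j, (φ (diagonalTorus x) : Matrix ι ι ℂ) *ᵥ b j =
        Complex.exp ((c * x j : ℝ) * Complex.I) • b j := by
  obtain ⟨b, c, hc, hb⟩ := exists_basis_map_diagonalTorus φ hφ hinj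
  refine ⟨b, c, ?_, hb⟩
  obtain ⟨p, q, hpq⟩ := exists_pair_ne ι
  have hsum (s : ℝ) : ∑ k, (Pi.single p s - Pi.single q s : ι → ℝ) k = 0 := by simp
  have hone {s : ℝ} (hs : Complex.exp (s * Complex.I) = 1) :
      diagonalTorus (Pi.single p s - Pi.single q s : ι → ℝ) = 1 := by
    refine Subtype.ext ?_
    rw [coe_diagonalTorus (hsum s), Submonoid.coe_one, diagonal_eq_one]
    funext j
    by_cases hjp : j = p
    · subst hjp; simp [hpq, hs]
    · by_cases hjq : j = q
      · subst hjq; simp [hjp, Complex.exp_neg, hs]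
      · simp [hjp, hjq]
  have hint {s : ℝ} (hs : Complex.exp (s * Complex.I) = 1) : ∃ k : ℤ, s = k * (2 * Real.pi) := by
    obtain ⟨k, hk⟩ := Complex.exp_eq_one_iff.mp hs
    refine ⟨k, ?_⟩
    have := congrArg Complex.im hk
    simpa using this
  have h2π : (2 * Real.pi) ≠ 0 := by positivity
  obtain ⟨k, hk⟩ : ∃ k : ℤ, c = k := by
    have h1 : Complex.exp ((2 * Real.pi : ℝ) * Complex.I) = 1 := by simp [Complex.exp_two_pi_mul_I]
    have h := hb _ (hsum (2 * Real.pi)) p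
    rw [hone h1, map_one, Submonoid.coe_one, one_mulVec] at h
    have h3 := smul_left_injective ℂ (b.ne_zero p) ((one_smul ℂ (b p)).trans h)
    obtain ⟨k, hk⟩ := hint h3.symm
    refine ⟨k, mul_right_cancel₀ h2π ?_⟩
    simpa [hpq] using hk
  obtain ⟨l, hl⟩ : ∃ l : ℤ, c⁻¹ = l := by
    set s := c⁻¹ * (2 * Real.pi)
    have hcs : c * s = 2 * Real.pi := by simp [s, hc]
    have h1 : φ (diagonalTorus (Pi.single p s - Pi.single q s : ι → ℝ)) = 1 := by
      refine Subtype.ext (eq_one_of_mulVec_basis b fun j => ?_)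
      rw [hb _ (hsum s)]
      by_cases hjp : j = p
      · subst hjp; simp [hpq, hcs, Complex.exp_two_pi_mul_I]
      · by_cases hjq : j = q
        · subst hjq; simp [hjp, hcs, Complex.exp_neg, Complex.exp_two_pi_mul_I]
        · simp [hjp, hjq]
    have h2 := congrArg Subtype.val (hinj (h1.trans (map_one φ).symm))
    rw [coe_diagonalTorus (hsum s)] at h2
    have h3 := congrFun (congrFun h2 p) p
    simp only [diagonal_apply_eq, Pi.sub_apply, Pi.single_eq_same, Pi.single_eq_of_ne hpq,
      sub_zero, Submonoid.coe_one, one_apply_eq] at h3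
    obtain ⟨l, hl⟩ := hint h3
    exact ⟨l, mul_right_cancel₀ h2π hl⟩
  have hkl : k * l = 1 := by
    have : (k : ℝ) * l = 1 := by rw [← hk, ← hl, mul_inv_cancel₀ hc]
    exact_mod_cast this
  rcases Int.eq_one_or_neg_one_of_mul_eq_one hkl with h | h
  · left; simp [hk, h]
  · right; simp [hk, h]

/-- Entrywise complex conjugation as an automorphism of the special unitary group. -/
def Matrix.specialUnitaryGroupConj : specialUnitaryGroup ι ℂ ≃* specialUnitaryGroup ι ℂ :=
  have hmem (g : specialUnitaryGroup ι ℂ) :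
      (g : Matrix ι ι ℂ).map (starRingEnd ℂ) ∈ specialUnitaryGroup ι ℂ := by
    obtain ⟨hu, hd⟩ := mem_specialUnitaryGroup_iff.mp g.2
    refine mem_specialUnitaryGroup_iff.mpr ⟨?_, ?_⟩
    · rw [mem_unitaryGroup_iff', star_eq_conjTranspose] at hu ⊢
      change (g : Matrix ι ι ℂ)ᴴ.map (starRingEnd ℂ) * _ = 1
      rw [← Matrix.map_mul, hu, Matrix.map_one _ (map_zero _) (map_one _)]
    · rw [← RingHom.mapMatrix_apply, ← RingHom.map_det, hd, map_one]
  { toFun := fun g => ⟨(g : Matrix ι ι ℂ).map (starRingEnd ℂ), hmem g⟩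
    invFun := fun g => ⟨(g : Matrix ι ι ℂ).map (starRingEnd ℂ), hmem g⟩
    left_inv := fun g => Subtype.ext (by ext; simp)
    right_inv := fun g => Subtype.ext (by ext; simp)
    map_mul' := fun g h => Subtype.ext (by simp [Matrix.map_mul]) }

/-- A continuous automorphism of the special unitary group is inner, up to complex conjugation. -/
theorem exists_conj_or_conj_map_star [Nontrivial ι]
    (φ : specialUnitaryGroup ι ℂ ≃* specialUnitaryGroup ι ℂ) (hφ : Continuous φ) :
    ∃ h ∈ specialUnitaryGroup ι ℂ,
      (∀ g : specialUnitaryGroup ι ℂ, (φ g : Matrix ι ι ℂ) = h * g * h⁻¹) ∨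
        ∀ g : specialUnitaryGroup ι ℂ,
          (φ g : Matrix ι ι ℂ) = h * (g : Matrix ι ι ℂ).map (starRingEnd ℂ) * h⁻¹ := by
  obtain ⟨b, c, hc, hb⟩ := exists_basis_map_diagonalTorus_sign φ.toMonoidHom hφ φ.injective
  have htrace (g : specialUnitaryGroup ι ℂ) : ∃ x : ι → ℝ,
      trace (g : Matrix ι ι ℂ) = ∑ j, Complex.exp (x j * Complex.I) ∧
      trace (φ g : Matrix ι ι ℂ) = ∑ j, Complex.exp ((c * x j : ℝ) * Complex.I) := by
    obtain ⟨h, x, hx, rfl⟩ := exists_eq_conj_diagonalTorus g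
    exact ⟨x, (trace_map_eq_trace_map_diagonalTorus (MonoidHom.id _) h x).trans
      (trace_diagonalTorus hx), (trace_map_eq_trace_map_diagonalTorus φ.toMonoidHom h x).trans
      (trace_eq_sum_of_mulVec_basis b (hb x hx))⟩
  rcases hc with rfl | rfl
  · obtain ⟨h, hh, hφh⟩ := exists_conj_of_trace_eq φ fun g => by
      obtain ⟨x, hg, hφg⟩ := htrace g
      simp [hg, hφg]
    exact ⟨h, hh, Or.inl hφh⟩
  · obtain ⟨h, hh, hφh⟩ := exists_conj_of_trace_eq (specialUnitaryGroupConj.trans φ) fun g => by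
      obtain ⟨x, hg, hφg⟩ := htrace (specialUnitaryGroupConj g)
      have hconj : trace (g : Matrix ι ι ℂ) =
          starRingEnd ℂ (trace (specialUnitaryGroupConj g : Matrix ι ι ℂ)) := by
        simp [trace, specialUnitaryGroupConj]
      rw [MulEquiv.trans_apply, hφg, hconj, hg, map_sum]
      refine Finset.sum_congr rfl fun j _ => ?_
      rw [← Complex.exp_conj]
      simp
    refine ⟨h, hh, Or.inr fun g => ?_⟩
    have h2 : specialUnitaryGroupConj (specialUnitaryGroupConj g) = g :=
      specialUnitaryGroupConj.left_inv g
    have h3 := hφh (specialUnitaryGroupConj g)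
    rwa [MulEquiv.trans_apply, h2] at h3

end

/-- Every (continuous) automorphism of `SU(n)`, `n ≥ 2`, has either the form
`g ↦ h₀ g h₀⁻¹` or the form `g ↦ h₀ ḡ h₀⁻¹` for some `h₀ ∈ SU(n)`, where `ḡ` denotes
entrywise complex conjugation. -/
theorem stmt_0 (n : ℕ) (hn : 2 ≤ n)
    (φ : Matrix.specialUnitaryGroup (Fin n) ℂ ≃* Matrix.specialUnitaryGroup (Fin n) ℂ)
    (hφ : Continuous φ) :
    ∃ h₀ : Matrix (Fin n) (Fin n) ℂ, h₀ ∈ Matrix.specialUnitaryGroup (Fin n) ℂ ∧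
      ((∀ g : Matrix.specialUnitaryGroup (Fin n) ℂ,
          (φ g : Matrix (Fin n) (Fin n) ℂ) = h₀ * (g : Matrix (Fin n) (Fin n) ℂ) * h₀⁻¹) ∨
       (∀ g : Matrix.specialUnitaryGroup (Fin n) ℂ,
          (φ g : Matrix (Fin n) (Fin n) ℂ)
            = h₀ * ((g : Matrix (Fin n) (Fin n) ℂ).map (starRingEnd ℂ)) * h₀⁻¹)) := by
  have : Nontrivial (Fin n) := Fin.nontrivial_iff_two_le.mpr hn
  obtain ⟨h, hh, hφh⟩ := exists_conj_or_conj_map_star φ hφ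
  exact ⟨h, hh, hφh⟩
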